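/- Let G be a simple connected graph on a finite vertex type, and let L₁ and L₂ be nonempty disjoint sets of vertices with boundaries B₁ and B₂ respectively (the boundary of L is the set of vertices of L adjacent to some vertex outside L). If moreover B₁ and B₂ are nonempty, then the minimum graph distance over all pairs (q₁, q₂) with q₁ ∈ L₁ and q₂ ∈ L₂ equals the minimum graph distance over all pairs (b₁, b₂) with b₁ ∈ B₁ and b₂ ∈ B₂. Hence the b-overlap between two layouts can be determined by computing distances between boundary vertices only. -/

import Mathlib

theorem exists_boundary_dist_le {V : Type*} (G : SimpleGraph V) (L : Set V) {u v : V}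
    (p : G.Walk u v) (hu : u ∈ L) (hv : v ∉ L) :
    ∃ b ∈ {b | b ∈ L ∧ ∃ q, q ∉ L ∧ G.Adj b q}, G.dist b v ≤ p.length := by
  induction p with
  | nil => exact absurd hu hv
  | @cons a c d h p ih =>
    by_cases hc : c ∈ L
    · obtain ⟨b, hb, hle⟩ := ih hc hv
      exact ⟨b, hb, hle.trans (by simp)⟩
    · exact ⟨a, ⟨hu, c, hc, h⟩, SimpleGraph.dist_le (SimpleGraph.Walk.cons h p)⟩

/-- For a connected simple graph on a finite vertex type and nonempty
disjoint layouts `L₁`, `L₂` with nonempty boundaries `B₁`, `B₂`, the minimum graph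
distance over pairs from `L₁ × L₂` equals the minimum graph distance over pairs
from `B₁ × B₂`. -/
theorem min_dist_layouts_eq_min_dist_boundaries {V : Type*} [Fintype V]
    (G : SimpleGraph V) (hG : G.Connected)
    (L₁ L₂ : Set V) (h₁ : L₁.Nonempty) (h₂ : L₂.Nonempty) (hdisj : Disjoint L₁ L₂)
    (B₁ B₂ : Set V)
    (hB₁ : B₁ = {b | b ∈ L₁ ∧ ∃ q, q ∉ L₁ ∧ G.Adj b q})
    (hB₂ : B₂ = {b | b ∈ L₂ ∧ ∃ q, q ∉ L₂ ∧ G.Adj b q})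
    (hB₁ne : B₁.Nonempty) (hB₂ne : B₂.Nonempty) :
    sInf {n : ℕ | ∃ q₁ ∈ L₁, ∃ q₂ ∈ L₂, G.dist q₁ q₂ = n}
      = sInf {n : ℕ | ∃ b₁ ∈ B₁, ∃ b₂ ∈ B₂, G.dist b₁ b₂ = n} := by
  subst hB₁ hB₂
  apply le_antisymm
  · obtain ⟨x, hx⟩ := hB₁ne
    obtain ⟨y, hy⟩ := hB₂ne
    refine le_csInf ⟨_, x, hx, y, hy, rfl⟩ ?_
    rintro n ⟨b₁, hb₁, b₂, hb₂, rfl⟩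
    exact Nat.sInf_le ⟨b₁, hb₁.1, b₂, hb₂.1, rfl⟩
  · obtain ⟨x, hx⟩ := h₁
    obtain ⟨y, hy⟩ := h₂
    refine le_csInf ⟨_, x, hx, y, hy, rfl⟩ ?_
    rintro n ⟨q₁, hq₁, q₂, hq₂, rfl⟩
    obtain ⟨p, hp⟩ := hG.exists_walk_length_eq_dist q₁ q₂
    obtain ⟨b₁, hb₁, hle₁⟩ :=
      exists_boundary_dist_le G L₁ p hq₁ (fun h => Set.disjoint_left.1 hdisj h hq₂)
    obtain ⟨r, hr⟩ := hG.exists_walk_length_eq_dist q₂ b₁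
    obtain ⟨b₂, hb₂, hle₂⟩ :=
      exists_boundary_dist_le G L₂ r hq₂ (fun h => Set.disjoint_left.1 hdisj hb₁.1 h)
    refine le_trans (Nat.sInf_le (m := G.dist b₁ b₂) ⟨b₁, hb₁, b₂, hb₂, rfl⟩) ?_
    rw [SimpleGraph.dist_comm, ← hp]
    rw [hr, SimpleGraph.dist_comm (u := q₂)] at hle₂
    exact hle₂.trans hle₁
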